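/- arXiv:2604.14702 — 3 statements merged into one kernel-verified Lean document; each statement's English description precedes it below -/
import Mathlib

section
/- Define Y : ℝ² → ℝ³ by Y(φ) = (2 + φ₁, 2 + φ₂, 2), and let σ(t) = (1 + e^{−t})^{−1} be the logistic sigmoid. Then there exist a connected open neighborhood U ⊂ ℝ² of the origin and a smooth function X : U → ℝ such that, for all φ ∈ U: (i) 0 < ‖Y(φ)‖^{−1} < 1; (ii) Y(φ) ⊙ (σ(X(φ)), σ(X(φ)), σ(X(φ))) = Y(φ)/‖Y(φ)‖; and in particular (iii) the gated output μ_gat(φ) := Y(φ) ⊙ σ(X(φ) W_θ), with W_θ = (1, 1, 1) ∈ ℝ^{1×3} applied so that X(φ)W_θ = (X(φ), X(φ), X(φ)), has Euclidean norm ‖μ_gat(φ)‖ = 1 for every φ ∈ U. -/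
/-- The logistic sigmoid `σ(t) = (1 + e^{-t})⁻¹`. -/
noncomputable def logistic (t : ℝ) : ℝ := (1 + Real.exp (-t))⁻¹

/-- The Euclidean norm on `ℝ³` (as functions `Fin 3 → ℝ`). -/
noncomputable def enorm3 (y : Fin 3 → ℝ) : ℝ := Real.sqrt (∑ i, y i ^ 2)

theorem logistic_neg_log_sub_one {r : ℝ} (hr : 1 < r) :
    logistic (-Real.log (r - 1)) = r⁻¹ := by
  rw [logistic, neg_neg, Real.exp_log (sub_pos.mpr hr), add_sub_cancel]

theorem enorm3_smul {c : ℝ} (hc : 0 ≤ c) (y : Fin 3 → ℝ) :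
    enorm3 (c • y) = c * enorm3 y := by
  simp only [enorm3, Pi.smul_apply, smul_eq_mul, mul_pow, ← Finset.mul_sum]
  rw [Real.sqrt_mul (sq_nonneg c), Real.sqrt_sq hc]

theorem le_enorm3 (y : Fin 3 → ℝ) (i : Fin 3) : y i ≤ enorm3 y :=
  Real.le_sqrt_of_sq_le <|
    Finset.single_le_sum (f := fun j => y j ^ 2) (fun j _ => sq_nonneg (y j)) (Finset.mem_univ i)

theorem ContDiff.enorm3 {E : Type*} [NormedAddCommGroup E] [NormedSpace ℝ E] {n : WithTop ℕ∞}
    {f : E → Fin 3 → ℝ} (hf : ContDiff ℝ n f) (h : ∀ x, 0 < enorm3 (f x)) :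
    ContDiff ℝ n fun x => enorm3 (f x) :=
  (ContDiff.sum fun i _ => (contDiff_pi.mp hf i).pow 2).sqrt fun x =>
    (Real.sqrt_pos.mp (h x)).ne'

/-- For `Y(φ) = (2 + φ₁, 2 + φ₂, 2)` and the logistic sigmoid
`σ`, there exist a connected open neighborhood `U ⊆ ℝ²` of the origin and a
smooth `X : U → ℝ` such that for all `φ ∈ U`: (i) `0 < ‖Y(φ)‖⁻¹ < 1`;
(ii) `Y(φ) ⊙ (σ(X φ), σ(X φ), σ(X φ)) = Y(φ)/‖Y(φ)‖`; and in particular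
(iii) the gated output `μ_gat(φ) = Y(φ) ⊙ σ(X(φ) W_θ)` with
`W_θ = (1,1,1)` (so that `X(φ)W_θ = (X φ, X φ, X φ)`) has Euclidean norm `1`
for every `φ ∈ U`. -/
theorem stmt_5 (Y : (Fin 2 → ℝ) → (Fin 3 → ℝ))
    (hY : Y = fun φ => ![2 + φ 0, 2 + φ 1, 2]) :
    ∃ U : Set (Fin 2 → ℝ), IsOpen U ∧ IsConnected U ∧ (0 : Fin 2 → ℝ) ∈ U ∧
      ∃ X : (Fin 2 → ℝ) → ℝ, ContDiffOn ℝ (⊤ : ℕ∞) X U ∧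
        ∀ φ ∈ U,
          (0 < (enorm3 (Y φ))⁻¹ ∧ (enorm3 (Y φ))⁻¹ < 1) ∧
          (Y φ * (fun _ => logistic (X φ)) = (enorm3 (Y φ))⁻¹ • Y φ) ∧
          enorm3 (Y φ * (fun _ => logistic (X φ))) = 1 := by
  have two_le (φ) : 2 ≤ enorm3 (Y φ) := by
    simpa [hY] using le_enorm3 (Y φ) 2
  have one_lt (φ) : 1 < enorm3 (Y φ) := one_lt_two.trans_le (two_le φ)
  have pos (φ) : 0 < enorm3 (Y φ) := one_pos.trans (one_lt φ)
  have smooth : ContDiff ℝ (⊤ : ℕ∞) Y := by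
    rw [hY, contDiff_pi]
    intro i
    fin_cases i <;> simp <;> fun_prop
  refine ⟨Set.univ, isOpen_univ, isConnected_univ, Set.mem_univ _,
    fun φ => -Real.log (enorm3 (Y φ) - 1), ?_, fun φ _ => ?_⟩
  · exact (((smooth.enorm3 pos).sub contDiff_const).log
      fun φ => (sub_pos.mpr (one_lt φ)).ne').neg.contDiffOn
  · have gate : Y φ * (fun _ => logistic (-Real.log (enorm3 (Y φ) - 1))) =
        (enorm3 (Y φ))⁻¹ • Y φ := by
      ext i
      simp [logistic_neg_log_sub_one (one_lt φ), mul_comm]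
    refine ⟨⟨inv_pos.mpr (pos φ), inv_lt_one_of_one_lt₀ (one_lt φ)⟩, gate, ?_⟩
    rw [gate, enorm3_smul (inv_pos.mpr (pos φ)).le, inv_mul_cancel₀ (pos φ).ne']
end

section
/- Let U = (0, π/4) × (0, π/4) ⊂ ℝ² and let s : U → ℝ³ be the spherical patch s(φ₁, φ₂) = (cos φ₁ cos φ₂, cos φ₁ sin φ₂, sin φ₁). Let σ(t) = (1 + e^{−t})^{−1} be the logistic sigmoid, applied componentwise. Then there exist a ∈ ℝ³, B ∈ ℝ^{3×2} with rank(B) = 2, an integer m ≥ 3, a matrix W_θ ∈ ℝ^{m×3} with rank(W_θ) = 3, and a smooth map X_g : U → ℝ^{1×m}, such that for all φ ∈ U: (i) 0 < s_k(φ) < (a + Bφ)_k for each coordinate k = 1, 2, 3, and (ii) (a + Bφ) ⊙ σ(X_g(φ) W_θ) = s(φ). In particular the gated output has Euclidean norm 1 for every φ ∈ U, while the ungated output a + Bφ is affine in φ. -/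
open Real

/-- The log-odds of the ratio `p / y` realize that ratio as a gate value. -/
theorem mul_logistic_log_odds {p y : ℝ} (hp : 0 < p) (hpy : p < y) :
    y * logistic (log (p / (y - p))) = p := by
  have h : 0 < y - p := sub_pos.2 hpy
  have hy : 0 < y := hp.trans hpy
  rw [logistic, exp_neg, exp_log (div_pos hp h), inv_div]
  have : 1 + (y - p) / p = y / p := by field_simp; ring
  rw [this, inv_div, mul_div_cancel₀ _ hy.ne']

theorem contDiffOn_log_odds {E : Type*} [NormedAddCommGroup E] [NormedSpace ℝ E]
    {U : Set E} {n : WithTop ℕ∞} {p y : E → ℝ} (hp : ContDiffOn ℝ n p U)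
    (hy : ContDiffOn ℝ n y U) (h0 : ∀ x ∈ U, 0 < p x) (hpy : ∀ x ∈ U, p x < y x) :
    ContDiffOn ℝ n (fun x => log (p x / (y x - p x))) U :=
  (hp.div (hy.sub hp) fun x hx => (sub_pos.2 (hpy x hx)).ne').log
    fun x hx => (div_pos (h0 x hx) (sub_pos.2 (hpy x hx))).ne'

theorem rank_fin_three_two_one_zero :
    (!![1, 0; 0, 1; 0, 0] : Matrix (Fin 3) (Fin 2) ℝ).rank = 2 := by
  have h : LinearIndependent ℝ (!![1, 0; 0, 1; 0, 0] : Matrix (Fin 3) (Fin 2) ℝ).col := by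
    rw [← Matrix.mulVec_injective_iff]
    intro v w h
    ext i
    fin_cases i
    · simpa [Matrix.mulVec, dotProduct, Fin.sum_univ_succ] using congrFun h 0
    · simpa [Matrix.mulVec, dotProduct, Fin.sum_univ_succ] using congrFun h 1
  rw [← Matrix.rank_transpose]
  simpa using LinearIndependent.rank_matrix (M := Matrix.transpose _) h

/-- On `U = (0, π/4) × (0, π/4)` consider the spherical patch
`s(φ) = (cos φ₁ cos φ₂, cos φ₁ sin φ₂, sin φ₁)`. There exist `a ∈ ℝ³`,
`B ∈ ℝ^{3×2}` with `rank B = 2`, an integer `m ≥ 3`, a matrix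
`W_θ ∈ ℝ^{m×3}` with `rank W_θ = 3`, and a smooth gating input
`X_g : U → ℝ^{1×m}` such that for all `φ ∈ U`:
(i) `0 < s_k(φ) < (a + Bφ)_k` for each `k`;
(ii) `(a + Bφ) ⊙ σ(X_g(φ) W_θ) = s(φ)`; and in particular the gated output
has Euclidean norm `1` while the ungated output `a + Bφ` is affine. -/
theorem stmt_8 (U : Set (Fin 2 → ℝ))
    (hU : U = {φ | φ 0 ∈ Set.Ioo 0 (π / 4) ∧ φ 1 ∈ Set.Ioo 0 (π / 4)})
    (s : (Fin 2 → ℝ) → (Fin 3 → ℝ))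
    (hs : s = fun φ => ![cos (φ 0) * cos (φ 1), cos (φ 0) * sin (φ 1), sin (φ 0)]) :
    ∃ (a : Fin 3 → ℝ) (B : Matrix (Fin 3) (Fin 2) ℝ), B.rank = 2 ∧
    ∃ (m : ℕ), 3 ≤ m ∧
    ∃ (Wθ : Matrix (Fin m) (Fin 3) ℝ), Wθ.rank = 3 ∧
    ∃ (Xg : (Fin 2 → ℝ) → (Fin m → ℝ)), ContDiffOn ℝ (⊤ : ℕ∞) Xg U ∧
      ∀ φ ∈ U,
        (∀ k : Fin 3, 0 < s φ k ∧ s φ k < (a + B.mulVec φ) k) ∧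
        ((a + B.mulVec φ) * (fun k => logistic (Matrix.vecMul (Xg φ) Wθ k)) = s φ) ∧
        Real.sqrt (∑ k, ((a + B.mulVec φ) *
          (fun k => logistic (Matrix.vecMul (Xg φ) Wθ k))) k ^ 2) = 1 := by
  subst hU
  set U : Set (Fin 2 → ℝ) := {φ | φ 0 ∈ Set.Ioo 0 (π / 4) ∧ φ 1 ∈ Set.Ioo 0 (π / 4)}
  set a : Fin 3 → ℝ := fun _ => 2 with ha
  set B : Matrix (Fin 3) (Fin 2) ℝ := !![1, 0; 0, 1; 0, 0] with hB
  have hpos : ∀ k, ∀ φ ∈ U, 0 < s φ k := by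
    rintro k φ ⟨⟨h0, h0'⟩, h1, h1'⟩
    have c0 : 0 < cos (φ 0) := cos_pos_of_mem_Ioo ⟨by linarith, by linarith⟩
    have c1 : 0 < cos (φ 1) := cos_pos_of_mem_Ioo ⟨by linarith, by linarith⟩
    have s0 : 0 < sin (φ 0) := sin_pos_of_pos_of_lt_pi h0 (by linarith)
    have s1 : 0 < sin (φ 1) := sin_pos_of_pos_of_lt_pi h1 (by linarith)
    subst hs
    fin_cases k
    · exact mul_pos c0 c1
    · exact mul_pos c0 s1
    · exact s0
  have hsum : ∀ φ, ∑ k, s φ k ^ 2 = 1 := by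
    intro φ
    simp only [hs, Fin.sum_univ_three, Matrix.cons_val]
    linear_combination cos (φ 0) ^ 2 * sin_sq_add_cos_sq (φ 1) + sin_sq_add_cos_sq (φ 0)
  have hlt : ∀ k, ∀ φ ∈ U, s φ k < (a + B.mulVec φ) k := by
    rintro k φ ⟨⟨h0, -⟩, h1, -⟩
    have hk : s φ k ^ 2 ≤ 1 := hsum φ ▸
      Finset.single_le_sum (f := fun k => s φ k ^ 2) (fun _ _ => sq_nonneg _) (Finset.mem_univ k)
    have hk' : s φ k ≤ 1 := (abs_le.1 (sq_le_one_iff_abs_le_one _ |>.1 hk)).2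
    have hy : 2 ≤ (a + B.mulVec φ) k := by
      fin_cases k <;> simp [ha, hB, dotProduct, Fin.sum_univ_succ, h0.le, h1.le]
    linarith
  have hs_smooth : ∀ k, ContDiff ℝ (⊤ : ℕ∞) fun φ => s φ k := by
    intro k
    subst hs
    fin_cases k <;> simp only [Fin.zero_eta, Fin.mk_one, Fin.reduceFinMk, Matrix.cons_val] <;>
      fun_prop
  have hy_smooth : ∀ k, ContDiff ℝ (⊤ : ℕ∞) fun φ => (a + B.mulVec φ) k := by
    intro k
    simp only [Pi.add_apply, Matrix.mulVec, dotProduct]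
    fun_prop
  have hgate : ∀ φ ∈ U, (a + B.mulVec φ) * (fun k => logistic (Matrix.vecMul
      (fun k => log (s φ k / ((a + B.mulVec φ) k - s φ k))) (1 : Matrix (Fin 3) (Fin 3) ℝ) k)) =
      s φ := by
    intro φ hφ
    ext k
    rw [Matrix.vecMul_one]
    exact mul_logistic_log_odds (hpos k φ hφ) (hlt k φ hφ)
  refine ⟨a, B, rank_fin_three_two_one_zero, 3, le_rfl, 1, by simp,
    fun φ k => log (s φ k / ((a + B.mulVec φ) k - s φ k)),
    contDiffOn_pi.2 fun k => contDiffOn_log_odds (hs_smooth k).contDiffOn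
      (hy_smooth k).contDiffOn (hpos k) (hlt k), fun φ hφ =>
    ⟨fun k => ⟨hpos k φ hφ, hlt k φ hφ⟩, hgate φ hφ, ?_⟩⟩
  rw [hgate φ hφ, hsum, sqrt_one]
end

section
/- Let D ≥ 3 and m ≥ D, and let σ(t) = (1 + e^{−t})^{−1} be the logistic sigmoid applied componentwise. Then there exist a nonempty connected open set U ⊂ ℝ², an affine map Y : U → ℝ^D, Y(φ) = a + Bφ with rank(B) = 2, a smooth map X* : U → ℝ^{1×m}, a matrix W*_θ ∈ ℝ^{m×D}, and a smooth map s̃ : U → ℝ^D whose first three coordinates (s̃₁, s̃₂, s̃₃) satisfy s̃₁² + s̃₂² + s̃₃² = 1 at every point of U (a spherical patch) and whose remaining D − 3 coordinates are positive constants, such that Y(φ) ⊙ σ(X*(φ) W*_θ) = s̃(φ) for all φ ∈ U, and such that 0 < s̃_j(φ) < Y_j(φ) for all φ ∈ U and j = 1, …, D. -/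
/-- The logit of `s / y` realizes the gate `s / y`. -/
lemma mul_logistic_log_div_sub {s y : ℝ} (hs : 0 < s) (hy : s < y) :
    y * logistic (Real.log (s / (y - s))) = s := by
  have hys : 0 < y - s := sub_pos.2 hy
  have hy0 : y ≠ 0 := (hs.trans hy).ne'
  rw [logistic, Real.exp_neg, Real.exp_log (div_pos hs hys)]
  field_simp
  simp

/-- Any smooth map lying strictly between `0` and a smooth `Y` is a multiplicative gating of `Y`
with at least as many gating features as output coordinates. -/
lemma exists_gating {E : Type*} [NormedAddCommGroup E] [NormedSpace ℝ E] {D m : ℕ} (hm : D ≤ m)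
    {U : Set E} {Y s : E → Fin D → ℝ} (hY : ContDiffOn ℝ (⊤ : ℕ∞) Y U)
    (hs : ContDiffOn ℝ (⊤ : ℕ∞) s U) (hpos : ∀ φ ∈ U, ∀ j, 0 < s φ j ∧ s φ j < Y φ j) :
    ∃ X : E → Fin m → ℝ, ContDiffOn ℝ (⊤ : ℕ∞) X U ∧ ∃ W : Matrix (Fin m) (Fin D) ℝ,
      ∀ φ ∈ U, Y φ * (fun j => logistic (Matrix.vecMul (X φ) W j)) = s φ := by
  refine ⟨fun φ i => if h : (i : ℕ) < D then
      Real.log (s φ ⟨i, h⟩ / (Y φ ⟨i, h⟩ - s φ ⟨i, h⟩)) else 0, ?_,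
    Matrix.of fun i j => if i = Fin.castLE hm j then 1 else 0, fun φ hφ => ?_⟩
  · refine contDiffOn_pi.2 fun i => ?_
    by_cases h : (i : ℕ) < D
    · simp only [h, dif_pos]
      have hsi := contDiffOn_pi.1 hs ⟨i, h⟩
      have hYi := contDiffOn_pi.1 hY ⟨i, h⟩
      have hsub : ∀ φ ∈ U, Y φ ⟨i, h⟩ - s φ ⟨i, h⟩ ≠ 0 := fun φ hφ =>
        (sub_pos.2 (hpos φ hφ ⟨i, h⟩).2).ne'
      exact (hsi.div (hYi.sub hsi) hsub).log fun φ hφ =>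
        div_ne_zero (hpos φ hφ _).1.ne' (hsub φ hφ)
    · simpa only [h, dif_neg, not_false_eq_true] using contDiffOn_const
  · ext j
    simpa [Matrix.vecMul, dotProduct] using
      mul_logistic_log_div_sub (hpos φ hφ j).1 (hpos φ hφ j).2

/-- The matrix of the inclusion of the first `k` coordinates has full column rank. -/
lemma rank_coordinate_inclusion {k D : ℕ} (hk : k ≤ D) :
    (Matrix.of fun (j : Fin D) (i : Fin k) =>
      if j = Fin.castLE hk i then (1 : ℝ) else 0).rank = k := by
  set B : Matrix (Fin D) (Fin k) ℝ := Matrix.of fun j i => if j = Fin.castLE hk i then 1 else 0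
    with hB
  have hBB : B.transpose * B = 1 := by
    ext i j
    simp [hB, Matrix.mul_apply, Matrix.one_apply, eq_comm]
  rw [← Matrix.rank_transpose_mul_self, hBB, Matrix.rank_one, Fintype.card_fin]

/-- The upper hemisphere as a graph, with all further coordinates equal to `1`. -/
noncomputable def hemisphere (D : ℕ) (φ : Fin 2 → ℝ) (j : Fin D) : ℝ :=
  if (j : ℕ) = 0 then φ 0 else if (j : ℕ) = 1 then φ 1 else
    if (j : ℕ) = 2 then √(1 - φ 0 ^ 2 - φ 1 ^ 2) else 1

/-- The open square `(0, 1/2)²`, over which the upper hemisphere is smooth and positive. -/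
def halfSquare : Set (Fin 2 → ℝ) := Set.univ.pi fun _ => Set.Ioo 0 (1 / 2)

lemma radicand_pos {φ : Fin 2 → ℝ} (hφ : φ ∈ halfSquare) : 0 < 1 - φ 0 ^ 2 - φ 1 ^ 2 := by
  obtain ⟨h0, h0'⟩ := hφ 0 trivial
  obtain ⟨h1, h1'⟩ := hφ 1 trivial
  nlinarith

lemma contDiffOn_hemisphere (D : ℕ) :
    ContDiffOn ℝ (⊤ : ℕ∞) (hemisphere D) halfSquare := by
  refine contDiffOn_pi.2 fun j => ?_
  unfold hemisphere
  split_ifs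
  · fun_prop
  · fun_prop
  · exact ContDiffOn.sqrt (by fun_prop) fun φ hφ => (radicand_pos hφ).ne'
  · fun_prop

lemma hemisphere_pos {D : ℕ} {φ : Fin 2 → ℝ} (hφ : φ ∈ halfSquare) (j : Fin D) :
    0 < hemisphere D φ j := by
  unfold hemisphere
  split_ifs
  · exact (hφ 0 trivial).1
  · exact (hφ 1 trivial).1
  · exact Real.sqrt_pos.2 (radicand_pos hφ)
  · exact one_pos

lemma hemisphere_le_one {D : ℕ} {φ : Fin 2 → ℝ} (hφ : φ ∈ halfSquare) (j : Fin D) :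
    hemisphere D φ j ≤ 1 := by
  have h0 := (hφ 0 trivial).2
  have h1 := (hφ 1 trivial).2
  unfold hemisphere
  split_ifs
  · linarith
  · linarith
  · exact Real.sqrt_le_one.2 (by nlinarith [sq_nonneg (φ 0), sq_nonneg (φ 1)])
  · exact le_rfl

/-- (Positive-curvature realization, Theorem 3.17(ii).)
For `D ≥ 3` and `m ≥ D` there exist a nonempty connected open `U ⊆ ℝ²`, an
affine `Y(φ) = a + Bφ` with `rank B = 2`, a smooth gating input
`X* : U → ℝ^{1×m}`, a gating matrix `W*_θ ∈ ℝ^{m×D}`, and a smooth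
`s̃ : U → ℝ^D` whose first three coordinates parametrize a patch of the unit
sphere (`s̃₁² + s̃₂² + s̃₃² = 1` on `U`) and whose remaining `D − 3`
coordinates are positive constants, such that
`Y(φ) ⊙ σ(X*(φ) W*_θ) = s̃(φ)` on `U` and `0 < s̃_j(φ) < Y_j(φ)` for all
`φ ∈ U` and all `j`. -/
theorem stmt_15 (D m : ℕ) (hD : 3 ≤ D) (hm : D ≤ m) :
    ∃ U : Set (Fin 2 → ℝ), IsOpen U ∧ IsConnected U ∧
    ∃ (a : Fin D → ℝ) (B : Matrix (Fin D) (Fin 2) ℝ), B.rank = 2 ∧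
    ∃ X : (Fin 2 → ℝ) → (Fin m → ℝ), ContDiffOn ℝ (⊤ : ℕ∞) X U ∧
    ∃ (W : Matrix (Fin m) (Fin D) ℝ) (s : (Fin 2 → ℝ) → (Fin D → ℝ)),
      ContDiffOn ℝ (⊤ : ℕ∞) s U ∧
      (∀ φ ∈ U,
        s φ (⟨0, by omega⟩ : Fin D) ^ 2 + s φ (⟨1, by omega⟩ : Fin D) ^ 2 +
          s φ (⟨2, by omega⟩ : Fin D) ^ 2 = 1) ∧
      (∀ j : Fin D, 3 ≤ (j : ℕ) → ∃ t : ℝ, 0 < t ∧ ∀ φ ∈ U, s φ j = t) ∧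
      (∀ φ ∈ U,
        (a + B.mulVec φ) * (fun j => logistic (Matrix.vecMul (X φ) W j)) = s φ) ∧
      (∀ φ ∈ U, ∀ j : Fin D, 0 < s φ j ∧ s φ j < (a + B.mulVec φ) j) := by
  have hD2 : 2 ≤ D := by omega
  set B : Matrix (Fin D) (Fin 2) ℝ :=
    Matrix.of fun j i => if j = Fin.castLE hD2 i then 1 else 0 with hB
  have hlt : ∀ φ ∈ halfSquare, ∀ j : Fin D, 0 < hemisphere D φ j ∧
      hemisphere D φ j < ((fun _ => 2 : Fin D → ℝ) + B.mulVec φ) j := by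
    intro φ hφ j
    refine ⟨hemisphere_pos hφ j, (hemisphere_le_one hφ j).trans_lt ?_⟩
    have hnonneg : 0 ≤ B.mulVec φ j := by
      rw [Matrix.mulVec, dotProduct]
      refine Finset.sum_nonneg fun i _ => mul_nonneg ?_ (hφ i trivial).1.le
      rw [hB, Matrix.of_apply]
      split_ifs <;> norm_num
    rw [Pi.add_apply]
    linarith
  have hY : ContDiffOn ℝ (⊤ : ℕ∞) (fun φ => (fun _ => 2 : Fin D → ℝ) + B.mulVec φ) halfSquare :=
    (contDiff_const.add B.mulVecLin.toContinuousLinearMap.contDiff).contDiffOn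
  obtain ⟨X, hX, W, hW⟩ := exists_gating hm hY (contDiffOn_hemisphere D) hlt
  refine ⟨halfSquare, isOpen_set_pi Set.finite_univ fun _ _ => isOpen_Ioo,
    ⟨⟨fun _ => 1 / 4, fun _ _ => by norm_num⟩,
      (convex_pi fun _ _ => convex_Ioo _ _).isPreconnected⟩,
    fun _ => 2, B, rank_coordinate_inclusion hD2, X, hX, W, hemisphere D,
    contDiffOn_hemisphere D, fun φ hφ => ?_,
    fun j hj => ⟨1, one_pos, fun φ _ => ?_⟩, hW, hlt⟩
  · simp [hemisphere, Real.sq_sqrt (radicand_pos hφ).le]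
  · simp [hemisphere, show (j : ℕ) ≠ 0 by omega, show (j : ℕ) ≠ 1 by omega,
      show (j : ℕ) ≠ 2 by omega]
end
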